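/- arXiv:1311.3128 — 2 statements merged into one kernel-verified Lean document; each statement's English description precedes it below -/
import Mathlib

section
/- For every c ∈ ℝ there exists a Poiseuille-type profile V_c(x) = (v_c(x₂), 0)ᵀ with v_c ∈ H²(−1,1) ∩ H¹₀(−1,1) such that the mean flux condition 𝕊v_c = (1/2)∫_{−1}^1 v_c(x₂) dx₂ = c holds and, for large c, (1) ‖v_c‖_{L^∞} ∼ c, (2) ‖v_c'‖_{L²(−1,1)} ∼ c^{3/2}, (3) ‖v_c''‖_{L^{3/2}(−1,1)} ∼ c^{7/3}. Moreover, the linearized operator L_c w := −Δw + (V_c,∇)w + (w,∇)V_c is energy stable: there exists κ > 0 independent of c such that (L_c w, w)_{L²(Ω)} ≥ κ ‖w‖²_{H¹(Ω)} for every divergence-free w ∈ [H¹₀(Ω)]², where Ω = ℝ × (−1,1). -/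
noncomputable section
open MeasureTheory Real Set Filter

namespace NS

abbrev Pt := ℝ × ℝ

/-- The strip `Ω = ℝ × (-1,1)`. -/
def Strip : Set Pt := {x : Pt | x.2 ∈ Ioo (-1:ℝ) 1}
/-- `Ω_s = (s,s+1) × (-1,1)`. -/
def StripS (s : ℝ) : Set Pt := {x : Pt | x.1 ∈ Ioo s (s+1) ∧ x.2 ∈ Ioo (-1:ℝ) 1}

def e1 : Pt := (1, 0)
def e2 : Pt := (0, 1)

/-- Euclidean square norm on `ℝ²`. -/
def nsq (a : Pt) : ℝ := a.1 ^ 2 + a.2 ^ 2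
/-- Euclidean dot product on `ℝ²`. -/
def dot (a b : Pt) : ℝ := a.1 * b.1 + a.2 * b.2
/-- Euclidean norm on `ℝ²`. -/
def en (a : Pt) : ℝ := Real.sqrt (nsq a)

/-- Directional derivative. -/
def pd {E : Type*} [NormedAddCommGroup E] [NormedSpace ℝ E]
    (v : Pt) (f : Pt → E) (x : Pt) : E := fderiv ℝ f x v

/-- `|∇u|²` (Frobenius). -/
def gnsq (u : Pt → Pt) (x : Pt) : ℝ := nsq (pd e1 u x) + nsq (pd e2 u x)
/-- `∇u : ∇w`. -/
def gdot (u w : Pt → Pt) (x : Pt) : ℝ :=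
  dot (pd e1 u x) (pd e1 w x) + dot (pd e2 u x) (pd e2 w x)
/-- `|D²u|²`. -/
def h2sq (u : Pt → Pt) (x : Pt) : ℝ :=
  nsq (pd e1 (pd e1 u) x) + nsq (pd e1 (pd e2 u) x)
    + nsq (pd e2 (pd e1 u) x) + nsq (pd e2 (pd e2 u) x)

/-- Laplacian. -/
def lap (u : Pt → Pt) (x : Pt) : Pt := pd e1 (pd e1 u) x + pd e2 (pd e2 u) x
/-- Divergence. -/
def div2 (u : Pt → Pt) (x : Pt) : ℝ := (pd e1 u x).1 + (pd e2 u x).2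

/-- Mean flux `𝕊u₁(x₁) = ½∫_{-1}^1 u₁(x₁,y) dy`. -/
def flux (u : Pt → Pt) (x₁ : ℝ) : ℝ := (1/2) * ∫ y in Ioo (-1:ℝ) 1, (u (x₁, y)).1
/-- Stream function `Ψ(u)(x₁,x₂) = ∫_{-1}^{x₂} u₁(x₁,τ)dτ`. -/
def stream (u : Pt → Pt) (x : Pt) : ℝ := ∫ y in Ioo (-1:ℝ) x.2, (u (x.1, y)).1

/-- Weighted `L^p` norm with weight `φ(x₁)`. -/
def wLp (p : ℝ) (φ : ℝ → ℝ) (u : Pt → Pt) : ℝ :=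
  (∫ x in Strip, φ x.1 ^ p * en (u x) ^ p) ^ (1/p)
/-- Squared weighted `L²` norm. -/
def wL2sq (φ : ℝ → ℝ) (u : Pt → Pt) : ℝ := ∫ x in Strip, φ x.1 ^ 2 * nsq (u x)
/-- Squared weighted `W^{1,2}` norm. -/
def wH1sq (φ : ℝ → ℝ) (u : Pt → Pt) : ℝ :=
  ∫ x in Strip, φ x.1 ^ 2 * (nsq (u x) + gnsq u x)
/-- Squared weighted `W^{2,2}` norm. -/
def wH2sq (φ : ℝ → ℝ) (u : Pt → Pt) : ℝ :=
  ∫ x in Strip, φ x.1 ^ 2 * (nsq (u x) + gnsq u x + h2sq u x)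
/-- Squared weighted `W^{1,2}` norm of a scalar function. -/
def wH1sqS (φ : ℝ → ℝ) (f : Pt → ℝ) : ℝ :=
  ∫ x in Strip, φ x.1 ^ 2 * (f x ^ 2 + (pd e1 f x) ^ 2 + (pd e2 f x) ^ 2)

/-- `L^p` norm on `Ω_s`. -/
def locLp (p : ℝ) (s : ℝ) (u : Pt → Pt) : ℝ := (∫ x in StripS s, en (u x) ^ p) ^ (1/p)
/-- Uniformly local `L^p` norm. -/
def ulLp (p : ℝ) (u : Pt → Pt) : ℝ := ⨆ s : ℝ, locLp p s u
def locH1 (s : ℝ) (u : Pt → Pt) : ℝ :=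
  (∫ x in StripS s, (nsq (u x) + gnsq u x)) ^ ((1:ℝ)/2)
/-- Uniformly local `W^{1,2}` norm. -/
def ulH1 (u : Pt → Pt) : ℝ := ⨆ s : ℝ, locH1 s u
def locH2 (s : ℝ) (u : Pt → Pt) : ℝ :=
  (∫ x in StripS s, (nsq (u x) + gnsq u x + h2sq u x)) ^ ((1:ℝ)/2)
/-- Uniformly local `W^{2,2}` norm. -/
def ulH2 (u : Pt → Pt) : ℝ := ⨆ s : ℝ, locH2 s u

/-- Weight of exponential growth rate `μ` with constant `C`. -/
def ExpGrowth (μ C : ℝ) (φ : ℝ → ℝ) : Prop :=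
  (∀ x, 0 < φ x) ∧ ∀ x y : ℝ, φ (x + y) ≤ C * Real.exp (μ * |y|) * φ x

/-- The polynomial weight `θ_{ε,s}(x) = (1+ε²(x-s)²)^{-1/2}`. -/
def theta (ε s x : ℝ) : ℝ := (1 + ε ^ 2 * (x - s) ^ 2) ^ (-(1/2) : ℝ)

/-- Weak divergence-free, including vanishing normal trace:
`∫_Ω u·∇ψ = 0` for all `ψ ∈ C_c^∞(ℝ²)`. -/
def WeakDivFree (u : Pt → Pt) : Prop :=
  ∀ ψ : Pt → ℝ, ContDiff ℝ (⊤ : ℕ∞) ψ → HasCompactSupport ψ →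
    (∫ x in Strip, dot (u x) (pd e1 ψ x, pd e2 ψ x)) = 0

/-- Weak zero (Dirichlet) trace on `∂Ω`: integration by parts on `Ω` against
test functions of `ℝ²` produces no boundary terms. -/
def ZeroTrace (u : Pt → Pt) : Prop :=
  ∀ ψ : Pt → ℝ, ContDiff ℝ (⊤ : ℕ∞) ψ → HasCompactSupport ψ → ∀ v : Pt,
    (∫ x in Strip, ψ x • pd v u x) = - ∫ x in Strip, (pd v ψ x) • u x

/-- Membership in the uniformly local space `H_b`. -/
def MemHb (u : Pt → Pt) : Prop :=
  (∀ s : ℝ, IntegrableOn (fun x => nsq (u x)) (StripS s)) ∧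
  BddAbove (range fun s : ℝ => locLp 2 s u) ∧
  WeakDivFree u ∧ ∀ x₁ : ℝ, flux u x₁ = 0

/-- A Poiseuille-type profile `V(x) = (f(x₂),0)` with `f ∈ H²∩H¹₀(-1,1)` and flux `c`. -/
def IsPoiseuille (c : ℝ) (V : Pt → Pt) : Prop :=
  ∃ f : ℝ → ℝ, (∀ x, V x = (f x.2, 0)) ∧ Differentiable ℝ f ∧
    Differentiable ℝ (deriv f) ∧ f (-1) = 0 ∧ f 1 = 0 ∧
    IntegrableOn (fun y => f y ^ 2 + deriv f y ^ 2 + deriv (deriv f) y ^ 2) (Ioo (-1:ℝ) 1) ∧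
    (1/2) * (∫ y in Ioo (-1:ℝ) 1, f y) = c

/-- Time derivative of a space-time function. -/
def dt' (w : ℝ × Pt → Pt) (p : ℝ × Pt) : Pt := fderiv ℝ w p (1, (0 : Pt))
/-- Spatial directional derivative of a space-time function. -/
def dx (v : Pt) (w : ℝ × Pt → Pt) (p : ℝ × Pt) : Pt := fderiv ℝ w p ((0:ℝ), v)
/-- Spatial Laplacian of a space-time function. -/
def lapx (w : ℝ × Pt → Pt) (p : ℝ × Pt) : Pt := dx e1 (dx e1 w) p + dx e2 (dx e2 w) p
/-- Spatial divergence of a space-time function. -/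
def divx (w : ℝ × Pt → Pt) (p : ℝ × Pt) : ℝ := (dx e1 w p).1 + (dx e2 w p).2

/-- Local space-time `L²` norm of the gradient over a unit box. -/
def stGradLoc (T a s : ℝ) (u : ℝ → Pt → Pt) : ℝ :=
  (∫ t in Ioo a (a+1) ∩ Ioo 0 T, ∫ x in StripS s, gnsq (u t) x) ^ ((1:ℝ)/2)
/-- `‖∇u‖_{L²_b((0,T)×Ω)}`. -/
def ulGradST (T : ℝ) (u : ℝ → Pt → Pt) : ℝ := ⨆ p : ℝ × ℝ, stGradLoc T p.1 p.2 u

/-- The uniformly local energy norm of a solution on `[0,T]`. -/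
def energyNorm (T : ℝ) (u : ℝ → Pt → Pt) : ℝ :=
  (⨆ t : Icc (0:ℝ) T, ulLp 2 (u ↑t)) + ulGradST T u

/-- Continuity with values in the weighted `L²_φ` space. -/
def ContL2w (T : ℝ) (φ : ℝ → ℝ) (u : ℝ → Pt → Pt) : Prop :=
  ∀ t₀ ∈ Icc (0:ℝ) T, Tendsto (fun t => wL2sq φ (fun x => u t x - u t₀ x))
    (nhdsWithin t₀ (Icc 0 T)) (nhds 0)

/-- The energy class `L^∞(0,T;H_b) ∩ C([0,T];H_φ)`, `∇u ∈ L²_b((0,T)×Ω)`,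
with weak Dirichlet boundary conditions. -/
def EnergyClass (T : ℝ) (u : ℝ → Pt → Pt) : Prop :=
  (∀ t ∈ Icc (0:ℝ) T, MemHb (u t)) ∧
  BddAbove (range fun t : Icc (0:ℝ) T => ulLp 2 (u ↑t)) ∧
  BddAbove (range fun p : ℝ × ℝ => stGradLoc T p.1 p.2 u) ∧
  (∀ t ∈ Ioo (0:ℝ) T, ZeroTrace (u t)) ∧
  (∀ φ : ℝ → ℝ, (∃ μ C : ℝ, 0 < μ ∧ 0 < C ∧ ExpGrowth μ C φ) →
    Integrable (fun x : ℝ => φ x ^ 2) → ContL2w T φ u)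

/-- Distributional formulation of the Navier--Stokes equations on `(0,T)×Ω`
with initial datum `u₀`, tested against divergence-free test functions. -/
def NSEq (T : ℝ) (g : ℝ → Pt → Pt) (u0 : Pt → Pt) (u : ℝ → Pt → Pt) : Prop :=
  ∀ w : ℝ × Pt → Pt, ContDiff ℝ (⊤ : ℕ∞) w → HasCompactSupport w →
    tsupport w ⊆ (Iio T) ×ˢ Strip → (∀ p, divx w p = 0) →
    (∫ t in Ioo 0 T, ∫ x in Strip,
        (dot (u t x) (dt' w (t, x)) + dot (u t x) (lapx w (t, x))
          + dot (fderiv ℝ w (t, x) ((0:ℝ), u t x)) (u t x)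
          + dot (g t x) (w (t, x))))
      + (∫ x in Strip, dot (u0 x) (w (0, x))) = 0

/-- Distributional formulation of the nonstationary Stokes equations. -/
def StokesEq (T : ℝ) (g : ℝ → Pt → Pt) (u0 : Pt → Pt) (u : ℝ → Pt → Pt) : Prop :=
  ∀ w : ℝ × Pt → Pt, ContDiff ℝ (⊤ : ℕ∞) w → HasCompactSupport w →
    tsupport w ⊆ (Iio T) ×ˢ Strip → (∀ p, divx w p = 0) →
    (∫ t in Ioo 0 T, ∫ x in Strip,
        (dot (u t x) (dt' w (t, x)) + dot (u t x) (lapx w (t, x))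
          + dot (g t x) (w (t, x))))
      + (∫ x in Strip, dot (u0 x) (w (0, x))) = 0

/-- Weak (energy) solution of the Navier--Stokes problem with mean flux `c`. -/
def IsEnergyNS (T c : ℝ) (g : ℝ → Pt → Pt) (u0 : Pt → Pt) (u : ℝ → Pt → Pt) : Prop :=
  (∃ V : Pt → Pt, IsPoiseuille c V ∧ EnergyClass T (fun t x => u t x - V x)) ∧
  (∀ t ∈ Icc (0:ℝ) T, ∀ x₁ : ℝ, flux (u t) x₁ = c) ∧
  NSEq T g u0 u

/-- Weak (energy) solution of the nonstationary Stokes problem. -/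
def IsEnergyStokes (T : ℝ) (g : ℝ → Pt → Pt) (u0 : Pt → Pt) (u : ℝ → Pt → Pt) : Prop :=
  EnergyClass T u ∧ StokesEq T g u0 u

/-- The corrector `v_φ`: solution of the backward adjoint problem
`-∂ₜv - Δv + ∇q = 0`, `div v = 2φφ'u₁`, `v|_{∂Ω}=0`, `v|_{t=T} = (0,2φφ'Ψ(u(T)))`. -/
def IsCorrector (T : ℝ) (φ : ℝ → ℝ) (u v : ℝ → Pt → Pt) : Prop :=
  (∀ w : ℝ × Pt → Pt, ContDiff ℝ (⊤ : ℕ∞) w → HasCompactSupport w →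
      tsupport w ⊆ (Ioo 0 T) ×ˢ Strip → (∀ p, divx w p = 0) →
      (∫ t in Ioo 0 T, ∫ x in Strip,
        (dot (v t x) (dt' w (t, x)) - dot (v t x) (lapx w (t, x)))) = 0) ∧
  (∀ ψ : ℝ × Pt → ℝ, ContDiff ℝ (⊤ : ℕ∞) ψ → HasCompactSupport ψ →
      tsupport ψ ⊆ (Ioo 0 T) ×ˢ Strip →
      (∫ t in Ioo 0 T, ∫ x in Strip,
        (dot (v t x) (fderiv ℝ ψ (t, x) ((0:ℝ), e1), fderiv ℝ ψ (t, x) ((0:ℝ), e2))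
          + 2 * φ x.1 * deriv φ x.1 * (u t x).1 * ψ (t, x))) = 0) ∧
  (∀ᵐ x ∂(volume.restrict Strip),
      v T x = ((0:ℝ), 2 * φ x.1 * deriv φ x.1 * stream (u T) x)) ∧
  (∀ t ∈ Icc (0:ℝ) T, ∀ x₁ : ℝ, flux (v t) x₁ = 0) ∧
  (∀ t ∈ Icc (0:ℝ) T, ZeroTrace (fun x => ∫ r in t..T, v r x))

/-- Weighted Gagliardo seminorm of order `1/3` (squared). -/
def gag13 (φ : ℝ → ℝ) (z : Pt → Pt) : ℝ :=
  ∫ x in Strip, ∫ y in Strip, φ x.1 ^ 2 * nsq (z x - z y) / en (x - y) ^ ((2:ℝ) + 2/3)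
/-- Squared weighted `W^{1/3,2}_φ` norm. -/
def frac13sq (φ : ℝ → ℝ) (u : Pt → Pt) : ℝ := wL2sq φ u + gag13 φ u
/-- Squared weighted `W^{2+1/3,2}_φ` norm. -/
def frac2p13sq (φ : ℝ → ℝ) (u : Pt → Pt) : ℝ :=
  wH2sq φ u + gag13 φ (pd e1 (pd e1 u)) + gag13 φ (pd e1 (pd e2 u))
    + gag13 φ (pd e2 (pd e1 u)) + gag13 φ (pd e2 (pd e2 u))

/-- Local space-time `L^p` norm on a unit box in `ℝ₊ × Ω`. -/
def stLocLp (p a s : ℝ) (g : ℝ → Pt → Pt) : ℝ :=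
  (∫ t in Ioo a (a+1) ∩ Ioi 0, ∫ x in StripS s, en (g t x) ^ p) ^ (1/p)
/-- Local `L¹(L^{3/2})` norm on a unit box. -/
def L1L32loc (a s : ℝ) (g : ℝ → Pt → Pt) : ℝ :=
  ∫ t in Ioo a (a+1) ∩ Ioi 0, (∫ x in StripS s, en (g t x) ^ ((3:ℝ)/2)) ^ ((2:ℝ)/3)

/-- `g ∈ L^{4/3}_b(ℝ₊×Ω) ∩ L¹_b(ℝ₊;L^{3/2}_b(Ω))`. -/
def GClass (g : ℝ → Pt → Pt) : Prop :=
  BddAbove (range fun p : ℝ × ℝ => stLocLp ((4:ℝ)/3) p.1 p.2 g) ∧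
  BddAbove (range fun p : ℝ × ℝ => L1L32loc p.1 p.2 g)

/-- Distributionally curl-free on `Ω` (i.e. a gradient field on the strip). -/
def CurlFree (z : Pt → Pt) : Prop :=
  ∀ ψ : Pt → ℝ, ContDiff ℝ (⊤ : ℕ∞) ψ → HasCompactSupport ψ → tsupport ψ ⊆ Strip →
    (∫ x in Strip, dot (z x) (-(pd e2 ψ x), pd e1 ψ x)) = 0

/-- `v = Π w`: the Leray--Helmholtz projection of `w` in the uniformly local setting,
characterised by `v ∈ H_b` and `w - v` being a gradient field. -/
def IsLerayUL (w v : Pt → Pt) : Prop :=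
  MemHb v ∧ CurlFree (fun x => w x - v x)

/-- Cut-off functions `ψ` with `ψ ≡ 1` on `(0,1)` and `ψ ≡ 0` outside `(-1,2)`. -/
def IsCutoff (ψ : ℝ → ℝ) : Prop :=
  ContDiff ℝ (⊤ : ℕ∞) ψ ∧ HasCompactSupport ψ ∧ (∀ x ∈ Ioo (0:ℝ) 1, ψ x = 1) ∧
  ∀ x : ℝ, x ∉ Ioo (-1:ℝ) 2 → ψ x = 0

end NS
namespace NS

lemma cs_interval (h : ℝ → ℝ) (hc : Continuous h) (a b : ℝ) (hab : a < b) :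
    (∫ t in a..b, h t) ^ 2 ≤ (b - a) * ∫ t in a..b, h t ^ 2 := by
  set I := ∫ t in a..b, h t with hI
  set J := ∫ t in a..b, h t ^ 2 with hJ
  have hi : ∀ g : ℝ → ℝ, Continuous g → IntervalIntegrable g volume a b :=
    fun g hg => hg.intervalIntegrable _ _
  set s := I / (b - a) with hs
  have h0 : 0 ≤ ∫ t in a..b, (h t - s) ^ 2 :=
    intervalIntegral.integral_nonneg hab.le (fun t _ => sq_nonneg _)
  have h1 : ∫ t in a..b, (h t - s) ^ 2 = J - 2 * s * I + s ^ 2 * (b - a) := by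
    have : ∀ t, (h t - s) ^ 2 = (h t ^ 2 - (2 * s) * h t) + s ^ 2 := fun t => by ring
    simp_rw [this]
    rw [intervalIntegral.integral_add (hi _ (by fun_prop)) (hi _ (by fun_prop)),
      intervalIntegral.integral_sub (hi _ (by fun_prop)) (hi _ (by fun_prop)),
      intervalIntegral.integral_const_mul, intervalIntegral.integral_const]
    simp only [smul_eq_mul]; ring
  have hba : 0 < b - a := by linarith
  have h2 : s * (b - a) = I := by rw [hs]; field_simp
  rw [h1] at h0
  have h3 : 0 ≤ (b - a) * (J - 2 * s * I + s ^ 2 * (b - a)) := mul_nonneg hba.le h0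
  have h4 : (b - a) * (J - 2 * s * I + s ^ 2 * (b - a)) = (b - a) * J - I ^ 2 := by
    rw [← h2]; ring
  linarith

lemma pt_bound (g g' : ℝ → ℝ) (hd : ∀ t, HasDerivAt g (g' t) t) (hc : Continuous g')
    (hi : Integrable (fun t => g' t ^ 2)) (hm : g (-1) = 0) (hp : g 1 = 0)
    (y : ℝ) (hy : y ∈ Icc (-1:ℝ) 1) :
    g y ^ 2 ≤ (1 - |y|) * ∫ t, g' t ^ 2 := by
  have key : ∀ a b : ℝ, a ≤ b → (g b - g a) ^ 2 ≤ (b - a) * ∫ t, g' t ^ 2 := by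
    intro a b hab
    rcases hab.eq_or_lt with h | h
    · subst h; simp
    have e : ∫ t in a..b, g' t = g b - g a :=
      intervalIntegral.integral_eq_sub_of_hasDerivAt (fun t _ => hd t)
        (hc.intervalIntegrable _ _)
    rw [← e]
    refine (cs_interval g' hc a b h).trans ?_
    refine mul_le_mul_of_nonneg_left ?_ (by linarith)
    rw [intervalIntegral.integral_of_le h.le]
    exact setIntegral_le_integral hi (Eventually.of_forall fun t => sq_nonneg _)
  rcases le_total 0 y with h | h
  · have := key y 1 hy.2
    rw [hp] at this
    rw [abs_of_nonneg h]; nlinarith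
  · have := key (-1) y hy.1
    rw [hm] at this
    rw [abs_of_nonpos h]; nlinarith

lemma weighted (u : Pt → ℝ) (hu : ContDiff ℝ (⊤ : ℕ∞) u) (hs : HasCompactSupport u)
    (hz : ∀ x, x ∉ Strip → u x = 0) (h : ℝ → ℝ) (hc : Continuous h) (h0 : ∀ y, 0 ≤ h y) :
    ∫ x : Pt, h x.2 * u x ^ 2 ≤
      (∫ y in Icc (-1:ℝ) 1, h y * (1 - |y|)) * ∫ x : Pt, pd e2 u x ^ 2 := by
  have hpc : Continuous (pd e2 u) := by
    unfold pd
    exact (hu.continuous_fderiv (by simp)).clm_apply continuous_const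
  have hps : HasCompactSupport (pd e2 u) := hs.fderiv_apply (𝕜 := ℝ) e2
  have hps2 : HasCompactSupport (fun x => pd e2 u x ^ 2) := by
    have : HasCompactSupport (fun x => pd e2 u x * pd e2 u x) := hps.mul_left
    simpa [pow_two] using this
  have hus2 : HasCompactSupport (fun x : Pt => h x.2 * u x ^ 2) := by
    have : HasCompactSupport (fun x : Pt => (h x.2 * u x) * u x) := hs.mul_left
    simpa [pow_two, mul_assoc] using this
  have huc := hu.continuous
  have i1 : Integrable (fun x : Pt => h x.2 * u x ^ 2) :=
    Continuous.integrable_of_hasCompactSupport (by fun_prop) hus2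
  have i2 : Integrable (fun x : Pt => pd e2 u x ^ 2) :=
    Continuous.integrable_of_hasCompactSupport (by fun_prop) hps2
  have F1 : ∫ x : Pt, h x.2 * u x ^ 2 = ∫ a, ∫ b, h b * u (a, b) ^ 2 :=
    integral_prod (μ := (volume : Measure ℝ)) (ν := (volume : Measure ℝ)) _ i1
  have F2 : ∫ x : Pt, pd e2 u x ^ 2 = ∫ a, ∫ b, pd e2 u (a, b) ^ 2 :=
    integral_prod (μ := (volume : Measure ℝ)) (ν := (volume : Measure ℝ)) _ i2
  rw [F1, F2, ← integral_const_mul]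
  have I1 : Integrable (fun a : ℝ => ∫ b, h b * u (a, b) ^ 2) :=
    Integrable.integral_prod_left (μ := (volume : Measure ℝ)) (ν := (volume : Measure ℝ)) i1
  have I2 : Integrable (fun a : ℝ => ∫ b, pd e2 u (a, b) ^ 2) :=
    Integrable.integral_prod_left (μ := (volume : Measure ℝ)) (ν := (volume : Measure ℝ)) i2
  refine integral_mono I1 (I2.const_mul _) fun a => ?_
  simp only
  have hd : ∀ t, HasDerivAt (fun b => u (a, b)) (pd e2 u (a, t)) t := by
    intro t
    have h1 : HasFDerivAt u (fderiv ℝ u (a, t)) (a, t) :=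
      (hu.differentiable (by simp) _).hasFDerivAt
    have h2 : HasDerivAt (fun b : ℝ => ((a, b) : Pt)) e2 t :=
      (hasDerivAt_const t a).prodMk (hasDerivAt_id t)
    exact h1.comp_hasDerivAt t h2
  have hcl : Topology.IsClosedEmbedding (fun b : ℝ => ((a, b) : Pt)) := by
    refine Topology.IsClosedEmbedding.of_continuous_injective_isClosedMap (by fun_prop)
      (fun x y hxy => by simpa using hxy) ?_
    intro s hs
    have : (fun b : ℝ => ((a, b) : Pt)) '' s = {a} ×ˢ s := by
      ext ⟨p, q⟩; simp; tauto
    rw [this]; exact isClosed_singleton.prod hs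
  have hic : Integrable (fun t => pd e2 u (a, t) ^ 2) :=
    Continuous.integrable_of_hasCompactSupport (by fun_prop)
      (hps2.comp_isClosedEmbedding hcl)
  have hb := pt_bound (fun b => u (a, b)) (fun t => pd e2 u (a, t)) hd (by fun_prop) hic
    (hz _ (by simp [Strip])) (hz _ (by simp [Strip]))
  have e : ∫ b, h b * u (a, b) ^ 2 = ∫ b in Icc (-1:ℝ) 1, h b * u (a, b) ^ 2 := by
    symm
    refine setIntegral_eq_integral_of_forall_compl_eq_zero fun b hb' => ?_
    rw [hz (a, b) (fun hh => hb' ⟨hh.1.le, hh.2.le⟩)]; simp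
  rw [e, ← integral_mul_const]
  refine setIntegral_mono_on ?_ ?_ measurableSet_Icc fun b hb' => ?_
  · exact Continuous.integrableOn_Icc (by fun_prop)
  · exact Continuous.integrableOn_Icc (by fun_prop)
  · rw [mul_assoc]; exact mul_le_mul_of_nonneg_left (hb b hb') (h0 b)

lemma ibp (f g : Pt → ℝ) (hf : ContDiff ℝ 1 f) (hg : ContDiff ℝ 1 g)
    (hs : HasCompactSupport f) (v : Pt) :
    ∫ x, f x * pd v g x = - ∫ x, pd v f x * g x := by
  have c1 : Continuous (fun x => fderiv ℝ f x v) :=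
    (hf.continuous_fderiv (by simp)).clm_apply continuous_const
  have c2 : Continuous (fun x => fderiv ℝ g x v) :=
    (hg.continuous_fderiv (by simp)).clm_apply continuous_const
  have := hf.continuous
  have := hg.continuous
  refine integral_mul_fderiv_eq_neg_fderiv_mul_of_integrable ?_ ?_ ?_ ?_ ?_
  · exact Continuous.integrable_of_hasCompactSupport (by fun_prop)
      (hs.fderiv_apply (𝕜 := ℝ) v).mul_right
  · exact Continuous.integrable_of_hasCompactSupport (by fun_prop) hs.mul_right
  · exact Continuous.integrable_of_hasCompactSupport (by fun_prop) hs.mul_right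
  · exact fun x _ => hf.differentiable (by simp) x
  · exact fun x _ => hg.differentiable (by simp) x

end NS
namespace NS

lemma ci (f g : Pt → ℝ) (hf : Continuous f) (hg : Continuous g) (hs : HasCompactSupport f) :
    Integrable (fun x => f x * g x) :=
  Continuous.integrable_of_hasCompactSupport (by fun_prop) hs.mul_right

lemma iadd {f g : Pt → ℝ} (hf : Integrable f) (hg : Integrable g) :
    Integrable (fun x => f x + g x) := hf.add hg

lemma isub {f g : Pt → ℝ} (hf : Integrable f) (hg : Integrable g) :
    Integrable (fun x => f x - g x) := hf.sub hg

lemma ineg {f : Pt → ℝ} (hf : Integrable f) :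
    Integrable (fun x => - f x) := hf.neg

lemma pd_smooth (u : Pt → ℝ) (hu : ContDiff ℝ (⊤ : ℕ∞) u) (v : Pt) :
    ContDiff ℝ (⊤ : ℕ∞) (pd v u) := by
  unfold pd
  exact (hu.fderiv_right (m := (⊤ : ℕ∞)) (by simp)).clm_apply contDiff_const

lemma pd_pair (w : Pt → Pt) (hw : Differentiable ℝ w) (v : Pt) :
    pd v w = fun x => (pd v (fun y => (w y).1) x, pd v (fun y => (w y).2) x) := by
  funext x
  have h := (hw x).hasFDerivAt
  unfold pd
  rw [h.fst.fderiv, h.snd.fderiv]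
  rfl

/-- Scalar energy identity. -/
lemma scalar_energy (u : Pt → ℝ) (hu : ContDiff ℝ (⊤ : ℕ∞) u) (hs : HasCompactSupport u)
    (F : ℝ → ℝ) (hF : ContDiff ℝ (⊤ : ℕ∞) F) :
    ∫ x : Pt, u x * (-(pd e1 (pd e1 u) x + pd e2 (pd e2 u) x) + F x.2 * pd e1 u x)
      = ∫ x : Pt, (pd e1 u x ^ 2 + pd e2 u x ^ 2) := by
  have h1 := pd_smooth u hu e1
  have h2 := pd_smooth u hu e2
  have h11 := pd_smooth _ h1 e1
  have h22 := pd_smooth _ h2 e2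
  have s1 : HasCompactSupport (pd e1 u) := hs.fderiv_apply (𝕜 := ℝ) e1
  have s2 : HasCompactSupport (pd e2 u) := hs.fderiv_apply (𝕜 := ℝ) e2
  have k : ((1 : ℕ∞) : WithTop ℕ∞) ≤ ((⊤ : ℕ∞) : WithTop ℕ∞) := by exact_mod_cast le_top
  have a1 := ibp u (pd e1 u) (hu.of_le k) (h1.of_le k) hs e1
  have a2 := ibp u (pd e2 u) (hu.of_le k) (h2.of_le k) hs e2
  have hFs : ContDiff ℝ (⊤ : ℕ∞) (fun x : Pt => F x.2 * u x) :=
    (hF.comp contDiff_snd).mul hu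
  have a3 := ibp u (fun x => F x.2 * u x) (hu.of_le k) (hFs.of_le k) hs e1
  have d3 : ∀ x, pd e1 (fun x : Pt => F x.2 * u x) x = F x.2 * pd e1 u x := by
    intro x
    have q1 : HasFDerivAt u (fderiv ℝ u x) x := (hu.differentiable (by simp) x).hasFDerivAt
    have q2 : HasFDerivAt (fun x : Pt => F x.2) (deriv F x.2 • ContinuousLinearMap.snd ℝ ℝ ℝ) x :=
      ((hF.differentiable (by simp) x.2).hasDerivAt).comp_hasFDerivAt x hasFDerivAt_snd
    unfold pd
    have q4 : HasFDerivAt (fun x : Pt => F x.2 * u x) _ x := q2.mul q1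
    rw [q4.fderiv]
    simp [e1]
  simp_rw [d3] at a3
  have a3' : ∫ x : Pt, u x * (F x.2 * pd e1 u x) = 0 := by
    have : ∫ x : Pt, pd e1 u x * (F x.2 * u x) = ∫ x : Pt, u x * (F x.2 * pd e1 u x) := by
      congr 1; funext x; ring
    rw [this] at a3; linarith
  have c0 := hu.continuous
  have c1 := h1.continuous
  have c2 := h2.continuous
  have c11 := h11.continuous
  have c22 := h22.continuous
  have cF := hF.continuous
  have e : ∀ x : Pt, u x * (-(pd e1 (pd e1 u) x + pd e2 (pd e2 u) x) + F x.2 * pd e1 u x)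
      = (-(u x * pd e1 (pd e1 u) x) - u x * pd e2 (pd e2 u) x) + u x * (F x.2 * pd e1 u x) :=
    fun x => by ring
  simp_rw [e]
  have j1 := ci u (pd e1 (pd e1 u)) c0 c11 hs
  have j2 := ci u (pd e2 (pd e2 u)) c0 c22 hs
  have j3 := ci u (fun x => F x.2 * pd e1 u x) c0 (by fun_prop) hs
  rw [integral_add (isub (ineg j1) j2) j3, integral_sub (ineg j1) j2, integral_neg, a1, a2, a3']
  simp_rw [pow_two]
  rw [integral_add (ci _ _ c1 c1 s1) (ci _ _ c2 c2 s2)]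
  ring

lemma energy (F : ℝ → ℝ) (hF : ContDiff ℝ (⊤ : ℕ∞) F)
    (hM : ∫ y in Icc (-1:ℝ) 1, |deriv F y| * (1 - |y|) ≤ 1 / 2)
    (w : Pt → Pt) (hw : ContDiff ℝ (⊤ : ℕ∞) w) (hs : HasCompactSupport w)
    (ht : tsupport w ⊆ Strip) :
    (1/4) * (∫ x in Strip, (nsq (w x) + gnsq w x))
            ≤ ∫ x in Strip, dot (w x)
                (-(lap w x) + fderiv ℝ w x ((F x.2, 0) : Pt)
                  + fderiv ℝ (fun y : Pt => ((F y.2, 0) : Pt)) x (w x)) := by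
  set u : Pt → ℝ := fun y => (w y).1 with hu_def
  set v : Pt → ℝ := fun y => (w y).2 with hv_def
  have hu : ContDiff ℝ (⊤ : ℕ∞) u := hw.fst
  have hv : ContDiff ℝ (⊤ : ℕ∞) v := hw.snd
  have su : HasCompactSupport u := hs.comp_left (g := Prod.fst) rfl
  have sv : HasCompactSupport v := hs.comp_left (g := Prod.snd) rfl
  have zw : ∀ x, x ∉ Strip → w x = 0 := fun x hx => image_eq_zero_of_notMem_tsupport
    (fun h => hx (ht h))
  have zg : ∀ x, x ∉ Strip → fderiv ℝ w x = 0 := fun x hx => by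
    by_contra h
    exact hx (ht (support_fderiv_subset ℝ h))
  have zu : ∀ x, x ∉ Strip → u x = 0 := fun x hx => by simp [hu_def, zw x hx]
  have zv : ∀ x, x ∉ Strip → v x = 0 := fun x hx => by simp [hv_def, zw x hx]
  have hp : ∀ z, pd z w = fun x => (pd z u x, pd z v x) :=
    pd_pair w (hw.differentiable (by simp))
  have hpp : ∀ z x, pd z (pd z w) x = (pd z (pd z u) x, pd z (pd z v) x) := by
    intro z x
    have hd : Differentiable ℝ (pd z w) := by
      rw [hp z]
      exact ((pd_smooth u hu z).differentiable (by simp)).prodMk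
        ((pd_smooth v hv z).differentiable (by simp))
    rw [pd_pair (pd z w) hd z, hp z]
  rw [setIntegral_eq_integral_of_forall_compl_eq_zero (fun x hx => by
    simp [nsq, gnsq, pd, zw x hx, zg x hx]),
    setIntegral_eq_integral_of_forall_compl_eq_zero (fun x hx => by
    simp [dot, zw x hx])]
  have hu1 := pd_smooth u hu e1
  have hu2 := pd_smooth u hu e2
  have hu11 := (pd_smooth _ hu1 e1).continuous
  have hu22 := (pd_smooth _ hu2 e2).continuous
  have hv1 := pd_smooth v hv e1
  have hv2 := pd_smooth v hv e2
  have hv11 := (pd_smooth _ hv1 e1).continuous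
  have hv22 := (pd_smooth _ hv2 e2).continuous
  have cu := hu.continuous
  have cv := hv.continuous
  have cu1 := hu1.continuous
  have cu2 := hu2.continuous
  have cv1 := hv1.continuous
  have cv2 := hv2.continuous
  have cF := hF.continuous
  have cF' : Continuous (deriv F) := hF.continuous_deriv (by simp)
  have su1 : HasCompactSupport (pd e1 u) := su.fderiv_apply (𝕜 := ℝ) e1
  have su2 : HasCompactSupport (pd e2 u) := su.fderiv_apply (𝕜 := ℝ) e2
  have sv1 : HasCompactSupport (pd e1 v) := sv.fderiv_apply (𝕜 := ℝ) e1
  have sv2 : HasCompactSupport (pd e2 v) := sv.fderiv_apply (𝕜 := ℝ) e2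
  have Eint : ∀ x : Pt, dot (w x)
                (-(lap w x) + fderiv ℝ w x ((F x.2, 0) : Pt)
                  + fderiv ℝ (fun y : Pt => ((F y.2, 0) : Pt)) x (w x))
      = (u x * (-(pd e1 (pd e1 u) x + pd e2 (pd e2 u) x) + F x.2 * pd e1 u x)
        + v x * (-(pd e1 (pd e1 v) x + pd e2 (pd e2 v) x) + F x.2 * pd e1 v x))
        + u x * (deriv F x.2 * v x) := by
    intro x
    have q1 : fderiv ℝ w x ((F x.2, 0) : Pt) = F x.2 • pd e1 w x := by
      unfold pd
      rw [← map_smul]; simp [e1]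
    have q2 : HasFDerivAt (fun x : Pt => F x.2) (deriv F x.2 • ContinuousLinearMap.snd ℝ ℝ ℝ) x :=
      ((hF.differentiable (by simp) x.2).hasDerivAt).comp_hasFDerivAt x hasFDerivAt_snd
    have q3 : fderiv ℝ (fun y : Pt => ((F y.2, 0) : Pt)) x (w x) = (deriv F x.2 * v x, 0) := by
      rw [(q2.prodMk (hasFDerivAt_const (0:ℝ) x)).fderiv]
      simp [hv_def]
    rw [q1, q3, lap, hpp, hpp, hp e1]
    simp [dot, hu_def, hv_def]
    ring
  have Nint : ∀ x : Pt, nsq (w x) + gnsq w x = (1 * u x ^ 2 + 1 * v x ^ 2) +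
      ((pd e1 u x ^ 2 + pd e2 u x ^ 2) + (pd e1 v x ^ 2 + pd e2 v x ^ 2)) := by
    intro x
    rw [gnsq, hp, hp]; simp [nsq, hu_def, hv_def]; ring
  simp_rw [Eint, Nint]
  have sq : ∀ f : Pt → ℝ, Continuous f → HasCompactSupport f → Integrable (fun x => f x ^ 2) := by
    intro f hf hs
    simp_rw [pow_two]; exact ci f f hf hf hs
  have hsq : ∀ (h : ℝ → ℝ) (f : Pt → ℝ), Continuous h → Continuous f → HasCompactSupport f →
      Integrable (fun x : Pt => h x.2 * f x ^ 2) := by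
    intro h f hh hf hs
    have := ci f (fun x => h x.2 * f x) hf (by fun_prop) hs
    refine this.congr (Eventually.of_forall fun x => ?_)
    simp only; ring
  have Mcont : Continuous (fun y => |deriv F y|) := cF'.abs
  have W1u := weighted u hu su zu (fun _ => 1) continuous_const (fun _ => zero_le_one)
  have W1v := weighted v hv sv zv (fun _ => 1) continuous_const (fun _ => zero_le_one)
  have WMu := weighted u hu su zu (fun y => |deriv F y|) Mcont (fun _ => abs_nonneg _)
  have WMv := weighted v hv sv zv (fun y => |deriv F y|) Mcont (fun _ => abs_nonneg _)
  have one : ∫ y in Icc (-1:ℝ) 1, 1 * (1 - |y|) ≤ 2 := by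
    calc ∫ y in Icc (-1:ℝ) 1, 1 * (1 - |y|) ≤ ∫ y in Icc (-1:ℝ) 1, (1:ℝ) := by
          refine setIntegral_mono_on (Continuous.integrableOn_Icc (by fun_prop))
            (Continuous.integrableOn_Icc (by fun_prop)) measurableSet_Icc fun y _ => ?_
          have := abs_nonneg y
          linarith
      _ = 2 := by simp; norm_num
  have iu : Integrable (fun x : Pt => pd e1 u x ^ 2 + pd e2 u x ^ 2) :=
    (sq _ cu1 su1).add (sq _ cu2 su2)
  have iv : Integrable (fun x : Pt => pd e1 v x ^ 2 + pd e2 v x ^ 2) :=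
    (sq _ cv1 sv1).add (sq _ cv2 sv2)
  have i1u : Integrable (fun x : Pt => 1 * u x ^ 2) := hsq (fun _ => 1) u continuous_const cu su
  have i1v : Integrable (fun x : Pt => 1 * v x ^ 2) := hsq (fun _ => 1) v continuous_const cv sv
  have iMu := hsq _ u Mcont cu su
  have iMv := hsq _ v Mcont cv sv
  have iL : ∀ f : Pt → ℝ, ContDiff ℝ (⊤ : ℕ∞) f → HasCompactSupport f →
      Integrable (fun x : Pt => f x * (-(pd e1 (pd e1 f) x + pd e2 (pd e2 f) x)
        + F x.2 * pd e1 f x)) := by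
    intro f hf hs
    have a1 := (pd_smooth f hf e1)
    have a2 := (pd_smooth f hf e2)
    have a1' := a1.continuous
    have a11 := (pd_smooth _ a1 e1).continuous
    have a22 := (pd_smooth _ a2 e2).continuous
    exact ci f _ hf.continuous (by fun_prop) hs
  have iC := ci u (fun x => deriv F x.2 * v x) cu (by fun_prop) su
  rw [integral_add (iadd (iL u hu su) (iL v hv sv)) iC, integral_add (iL u hu su) (iL v hv sv),
    scalar_energy u hu su F hF, scalar_energy v hv sv F hF,
    integral_add (iadd i1u i1v) (iadd iu iv), integral_add i1u i1v, integral_add iu iv]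
  have cross : -(∫ x : Pt, u x * (deriv F x.2 * v x)) ≤
      (1/2) * ((∫ x : Pt, |deriv F x.2| * u x ^ 2) + ∫ x : Pt, |deriv F x.2| * v x ^ 2) := by
    rw [← integral_neg, ← integral_add iMu iMv, ← integral_const_mul]
    refine integral_mono iC.neg ((iMu.add iMv).const_mul _) fun x => ?_
    simp only [Pi.add_apply]
    rcases abs_cases (deriv F x.2) with ⟨h, h'⟩ | ⟨h, h'⟩ <;> rw [h]
    · nlinarith [mul_nonneg h' (sq_nonneg (u x + v x))]
    · nlinarith [mul_nonneg (neg_nonneg.2 h'.le) (sq_nonneg (u x - v x))]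
  have pu : ∫ x : Pt, pd e2 u x ^ 2 ≤ ∫ x : Pt, (pd e1 u x ^ 2 + pd e2 u x ^ 2) :=
    integral_mono (sq _ cu2 su2) iu fun x => by simp only; nlinarith [sq_nonneg (pd e1 u x)]
  have pv : ∫ x : Pt, pd e2 v x ^ 2 ≤ ∫ x : Pt, (pd e1 v x ^ 2 + pd e2 v x ^ 2) :=
    integral_mono (sq _ cv2 sv2) iv fun x => by simp only; nlinarith [sq_nonneg (pd e1 v x)]
  have nu : 0 ≤ ∫ x : Pt, pd e2 u x ^ 2 := integral_nonneg fun x => sq_nonneg _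
  have nv : 0 ≤ ∫ x : Pt, pd e2 v x ^ 2 := integral_nonneg fun x => sq_nonneg _
  have W1u' := W1u.trans (mul_le_mul_of_nonneg_right one nu)
  have W1v' := W1v.trans (mul_le_mul_of_nonneg_right one nv)
  have WMu' := WMu.trans (mul_le_mul_of_nonneg_right hM nu)
  have WMv' := WMv.trans (mul_le_mul_of_nonneg_right hM nv)
  linarith

end NS
namespace NS

lemma int_abs_pow (k : ℕ) : ∫ y in Ioo (-1:ℝ) 1, |y| ^ k = 2 / (k + 1) := by
  rw [← integral_Ioc_eq_integral_Ioo, ← intervalIntegral.integral_of_le (by norm_num)]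
  have hc : Continuous (fun y : ℝ => |y| ^ k) := by fun_prop
  rw [← intervalIntegral.integral_add_adjacent_intervals (b := 0)
    (hc.intervalIntegrable _ _) (hc.intervalIntegrable _ _)]
  have h1 : ∫ y in (0:ℝ)..1, |y| ^ k = 1 / (k + 1) := by
    rw [intervalIntegral.integral_congr (g := fun y => y ^ k), integral_pow]
    · simp
    · intro y hy
      rw [uIcc_of_le zero_le_one] at hy
      simp [abs_of_nonneg hy.1]
  have h2 : ∫ y in (-1:ℝ)..0, |y| ^ k = ∫ y in (0:ℝ)..1, |y| ^ k := by
    have := intervalIntegral.integral_comp_neg (a := (0:ℝ)) (b := 1) (fun y : ℝ => |y| ^ k)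
    simp only [abs_neg, neg_zero] at this
    exact this.symm
  rw [h2, h1]; ring

/-- The polynomial profile. -/
def prof (m : ℕ) (a : ℝ) (y : ℝ) : ℝ := a * (1 - y ^ (2 * m + 2))

lemma prof_smooth (m : ℕ) (a : ℝ) : ContDiff ℝ (⊤ : ℕ∞) (prof m a) := by
  unfold prof; fun_prop

lemma prof_deriv (m : ℕ) (a : ℝ) :
    deriv (prof m a) = fun y => -(a * (2 * m + 2)) * y ^ (2 * m + 1) := by
  funext y
  have h : HasDerivAt (prof m a) _ y := ((hasDerivAt_pow (2 * m + 2) y).const_sub 1).const_mul a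
  rw [h.deriv]; push_cast
  ring

lemma prof_deriv2 (m : ℕ) (a : ℝ) :
    deriv (deriv (prof m a)) = fun y => -(a * (2 * m + 2) * (2 * m + 1)) * y ^ (2 * m) := by
  rw [prof_deriv]
  funext y
  rw [((hasDerivAt_pow (2 * m + 1) y).const_mul _).deriv]; push_cast
  ring

lemma prof_int (m : ℕ) (a : ℝ) :
    ∫ y in Ioo (-1:ℝ) 1, prof m a y = a * (2 - 2 / (2 * m + 3)) := by
  have e : ∀ y, prof m a y = a * (|y| ^ 0 - |y| ^ (2 * m + 2)) := fun y => by
    rw [prof, pow_zero, Even.pow_abs ⟨m + 1, by ring⟩]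
  have hi : ∀ k : ℕ, IntegrableOn (fun y : ℝ => |y| ^ k) (Ioo (-1) 1) := fun k =>
    (Continuous.integrableOn_Icc (by fun_prop)).mono_set Ioo_subset_Icc_self
  simp_rw [e]
  rw [integral_const_mul, integral_sub (hi 0) (hi _), int_abs_pow, int_abs_pow]
  push_cast; ring

lemma prof_M (m : ℕ) (a : ℝ) :
    ∫ y in Icc (-1:ℝ) 1, |deriv (prof m a) y| * (1 - |y|) = 2 * |a| / (2 * m + 3) := by
  have e : ∀ y, |deriv (prof m a) y| * (1 - |y|)
      = (|a| * (2 * m + 2)) * (|y| ^ (2 * m + 1) - |y| ^ (2 * m + 2)) := fun y => by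
    rw [prof_deriv]; simp only
    rw [abs_mul, abs_neg, abs_mul, abs_pow, abs_of_nonneg (by positivity : (0:ℝ) ≤ 2 * m + 2)]
    ring
  have hi : ∀ k : ℕ, IntegrableOn (fun y : ℝ => |y| ^ k) (Ioo (-1) 1) := fun k =>
    (Continuous.integrableOn_Icc (by fun_prop)).mono_set Ioo_subset_Icc_self
  simp_rw [e]
  rw [integral_Icc_eq_integral_Ioc, integral_Ioc_eq_integral_Ioo, integral_const_mul,
    integral_sub (hi _) (hi _), int_abs_pow, int_abs_pow]
  push_cast
  field_simp
  ring

lemma prof_D1 (m : ℕ) (a : ℝ) :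
    ∫ y in Ioo (-1:ℝ) 1, deriv (prof m a) y ^ 2 = (a * (2 * m + 2)) ^ 2 * (2 / (4 * m + 3)) := by
  have e : ∀ y, deriv (prof m a) y ^ 2
      = (a * (2 * m + 2)) ^ 2 * |y| ^ (4 * m + 2) := fun y => by
    rw [prof_deriv, Even.pow_abs ⟨2 * m + 1, by ring⟩]; simp only
    ring
  simp_rw [e]
  rw [integral_const_mul, int_abs_pow]
  push_cast; ring

lemma prof_D2 (m : ℕ) (a : ℝ) (ha : 0 ≤ a) :
    ∫ y in Ioo (-1:ℝ) 1, |deriv (deriv (prof m a)) y| ^ ((3:ℝ)/2)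
      = (a * (2 * m + 2) * (2 * m + 1)) ^ ((3:ℝ)/2) * (2 / (3 * m + 1)) := by
  have e : ∀ y, |deriv (deriv (prof m a)) y| ^ ((3:ℝ)/2)
      = (a * (2 * m + 2) * (2 * m + 1)) ^ ((3:ℝ)/2) * |y| ^ (3 * m) := fun y => by
    rw [prof_deriv2]; simp only
    rw [abs_mul, abs_neg, abs_pow, abs_of_nonneg (by positivity : 0 ≤ a * (2 * m + 2) * (2 * m + 1)),
      Real.mul_rpow (by positivity) (by positivity), ← Real.rpow_natCast, ← Real.rpow_natCast,
      ← Real.rpow_mul (abs_nonneg _)]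
    congr 2
    push_cast; ring
  simp_rw [e]
  rw [integral_const_mul, int_abs_pow]
  push_cast; ring

lemma prof_sup (m : ℕ) (a : ℝ) (ha : 0 ≤ a) : (⨆ y : Icc (-1:ℝ) 1, |prof m a ↑y|) = a := by
  have hb : ∀ y : Icc (-1:ℝ) 1, |prof m a ↑y| ≤ a := by
    rintro ⟨y, hy⟩
    have h1 : 0 ≤ y ^ (2 * m + 2) := Even.pow_nonneg ⟨m + 1, by ring⟩ y
    have h2 : y ^ (2 * m + 2) ≤ 1 := by
      rw [← Even.pow_abs ⟨m + 1, by ring⟩]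
      exact pow_le_one₀ (abs_nonneg _) (abs_le.2 hy)
    simp only [prof]
    rw [abs_of_nonneg (mul_nonneg ha (by linarith))]
    nlinarith
  have : Nonempty (Icc (-1:ℝ) 1) := ⟨⟨0, by norm_num⟩⟩
  apply le_antisymm (ciSup_le hb)
  have := le_ciSup (f := fun y : Icc (-1:ℝ) 1 => |prof m a ↑y|)
    ⟨a, by rintro _ ⟨y, rfl⟩; exact hb y⟩ ⟨0, by norm_num⟩
  simpa [prof, abs_of_nonneg ha] using this

/-- Integer exponent `m(c)`. -/
def mm (c : ℝ) : ℕ := 2 * ⌈|c|⌉₊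
/-- Amplitude `a(c)`. -/
def aa (c : ℝ) : ℝ := c * (2 * (mm c : ℝ) + 3) / (2 * (mm c : ℝ) + 2)

lemma mm_lb (c : ℝ) : 2 * |c| ≤ (mm c : ℝ) := by
  have := Nat.le_ceil |c|
  unfold mm; push_cast; linarith

lemma mm_ub (c : ℝ) : (mm c : ℝ) ≤ 2 * |c| + 2 := by
  have := Nat.ceil_lt_add_one (abs_nonneg c)
  unfold mm; push_cast; linarith

lemma M_bound (c : ℝ) : 2 * |aa c| / (2 * (mm c : ℝ) + 3) ≤ 1 / 2 := by
  have h := mm_lb c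
  have h0 : (0:ℝ) ≤ mm c := by positivity
  have e : |aa c| = |c| * (2 * (mm c : ℝ) + 3) / (2 * (mm c : ℝ) + 2) := by
    rw [aa, abs_div, abs_mul, abs_of_nonneg (by positivity : (0:ℝ) ≤ 2 * (mm c : ℝ) + 3),
      abs_of_nonneg (by positivity : (0:ℝ) ≤ 2 * (mm c : ℝ) + 2)]
  rw [e]
  have : 2 * (|c| * (2 * (mm c : ℝ) + 3) / (2 * (mm c : ℝ) + 2)) / (2 * (mm c : ℝ) + 3)
    = 2 * |c| / (2 * (mm c : ℝ) + 2) := by field_simp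
  rw [this, div_le_iff₀ (by positivity)]
  linarith

lemma is_pois (c : ℝ) : IsPoiseuille c (fun x => (prof (mm c) (aa c) x.2, 0)) := by
  refine ⟨prof (mm c) (aa c), fun x => rfl, (prof_smooth _ _).differentiable (by simp), ?_, ?_, ?_,
    ?_, ?_⟩
  · rw [prof_deriv]; fun_prop
  · simp [prof, Even.neg_one_pow (⟨mm c + 1, by ring⟩ : Even (2 * mm c + 2))]
  · simp [prof]
  · refine (Continuous.integrableOn_Icc ?_).mono_set Ioo_subset_Icc_self
    rw [prof_deriv2, prof_deriv]
    have := (prof_smooth (mm c) (aa c)).continuous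
    fun_prop
  · rw [prof_int, aa]
    field_simp
    ring

lemma aa_bounds (c : ℝ) (hc : 0 ≤ c) : c ≤ aa c ∧ aa c ≤ 3 / 2 * c := by
  have h0 : (0:ℝ) ≤ mm c := by positivity
  unfold aa
  rw [le_div_iff₀ (by positivity), div_le_iff₀ (by positivity)]
  constructor <;> nlinarith

lemma D1_bounds (c : ℝ) (hc : 1 ≤ c) :
    1 * c ^ ((3:ℝ)/2) ≤ ((aa c * (2 * mm c + 2)) ^ 2 * (2 / (4 * mm c + 3))) ^ ((1:ℝ)/2) ∧
    ((aa c * (2 * mm c + 2)) ^ 2 * (2 / (4 * mm c + 3))) ^ ((1:ℝ)/2) ≤ 10 * c ^ ((3:ℝ)/2) := by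
  obtain ⟨ha1, ha2⟩ := aa_bounds c (by linarith)
  have h1 := mm_lb c
  have h2 := mm_ub c
  rw [abs_of_nonneg (by linarith)] at h1 h2
  generalize aa c = a at *
  generalize (mm c : ℝ) = m at *
  have hc0 : 0 ≤ c := by linarith
  have e : c ^ ((3:ℝ)/2) = (c ^ 3) ^ ((1:ℝ)/2) := by
    rw [← Real.rpow_natCast, ← Real.rpow_mul hc0]; norm_num
  have e10 : (10:ℝ) = (100:ℝ) ^ ((1:ℝ)/2) := by
    rw [show (100:ℝ) = 10 ^ (2:ℝ) by norm_num, ← Real.rpow_mul (by norm_num)]; norm_num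
  have lb : c ^ 3 ≤ (a * (2 * m + 2)) ^ 2 * (2 / (4 * m + 3)) := by
    have t1 : c ^ 2 * (2 * m + 2) ^ 2 ≤ (a * (2 * m + 2)) ^ 2 := by
      rw [mul_pow]; gcongr
    rw [mul_div_assoc', le_div_iff₀ (by linarith)]
    have t2 : c * (4 * m + 3) ≤ (2 * m + 2) ^ 2 * 2 := by nlinarith
    nlinarith [mul_le_mul_of_nonneg_left t2 (sq_nonneg c)]
  have ub : (a * (2 * m + 2)) ^ 2 * (2 / (4 * m + 3)) ≤ 100 * c ^ 3 := by
    have t1 : (a * (2 * m + 2)) ^ 2 ≤ (3 / 2 * c) ^ 2 * (2 * m + 2) ^ 2 := by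
      rw [mul_pow]; gcongr
      · linarith
    rw [mul_div_assoc', div_le_iff₀ (by linarith)]
    have t2 : (2 * m + 2) ^ 2 * 2 * (9 / 4) ≤ 100 * c * (4 * m + 3) := by nlinarith
    nlinarith [mul_le_mul_of_nonneg_left t2 (sq_nonneg c)]
  constructor
  · rw [one_mul, e]
    exact Real.rpow_le_rpow (by positivity) lb (by norm_num)
  · rw [e, e10, ← Real.mul_rpow (by norm_num) (by positivity)]
    refine Real.rpow_le_rpow ?_ ub (by norm_num)
    exact le_trans (by positivity) lb

lemma D2_bounds (c : ℝ) (hc : 1 ≤ c) :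
    (1 / 100) * c ^ ((7:ℝ)/3) ≤ ((aa c * (2 * mm c + 2) * (2 * mm c + 1)) ^ ((3:ℝ)/2)
      * (2 / (3 * mm c + 1))) ^ ((2:ℝ)/3) ∧
    ((aa c * (2 * mm c + 2) * (2 * mm c + 1)) ^ ((3:ℝ)/2)
      * (2 / (3 * mm c + 1))) ^ ((2:ℝ)/3) ≤ 200 * c ^ ((7:ℝ)/3) := by
  obtain ⟨ha1, ha2⟩ := aa_bounds c (by linarith)
  have h1 := mm_lb c
  have h2 := mm_ub c
  rw [abs_of_nonneg (by linarith)] at h1 h2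
  generalize aa c = a at *
  generalize (mm c : ℝ) = m at *
  have hc0 : 0 < c := by linarith
  have hm : 0 < m := by linarith
  have ha : 0 < a := by linarith
  have e : ∀ K : ℝ, 0 ≤ K →
      ((K * c ^ 3) ^ ((3:ℝ)/2) * (1 / c)) ^ ((2:ℝ)/3) = K * c ^ ((7:ℝ)/3) := by
    intro K hK
    rw [Real.mul_rpow (by positivity) (by positivity), ← Real.rpow_mul (by positivity),
      one_div, ← Real.rpow_neg_one c, ← Real.rpow_mul hc0.le,
      show (3:ℝ) / 2 * (2 / 3) = 1 by norm_num, Real.rpow_one, mul_assoc, ← Real.rpow_natCast,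
      ← Real.rpow_add hc0]
    norm_num
  have B1 : 8 * c ^ 3 ≤ a * (2 * m + 2) * (2 * m + 1) := by
    calc 8 * c ^ 3 ≤ c * (2 * (2 * c)) * (2 * (2 * c)) := by nlinarith [pow_pos hc0 3]
      _ ≤ a * (2 * m + 2) * (2 * m + 1) := by gcongr <;> linarith
  have B2 : a * (2 * m + 2) * (2 * m + 1) ≤ 200 * c ^ 3 := by
    calc a * (2 * m + 2) * (2 * m + 1) ≤ (3 / 2 * c) * (10 * c) * (10 * c) := by
          gcongr <;> linarith
      _ ≤ 200 * c ^ 3 := by nlinarith [pow_pos hc0 3]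
  have I2 : 2 / (3 * m + 1) ≤ 1 / c := by
    rw [div_le_div_iff₀ (by positivity) hc0]; linarith
  have I1 : (1 / 8) * (1 / c) ≤ 2 / (3 * m + 1) := by
    rw [div_mul_div_comm, div_le_div_iff₀ (by positivity) (by positivity)]; linarith
  constructor
  · rw [← e (1/100) (by norm_num)]
    refine Real.rpow_le_rpow (by positivity) ?_ (by norm_num)
    have s1 : ((1 / 100) * c ^ 3) ^ ((3:ℝ)/2) ≤ (1 / 8) * (8 * c ^ 3) ^ ((3:ℝ)/2) := by
      rw [Real.mul_rpow (by norm_num) (by positivity), Real.mul_rpow (by norm_num) (by positivity),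
        ← mul_assoc]
      gcongr
      have q1 : ((1:ℝ) / 100) ^ ((3:ℝ)/2) ≤ (1 / 100) ^ (1:ℝ) :=
        Real.rpow_le_rpow_of_exponent_ge (by norm_num) (by norm_num) (by norm_num)
      have q2 : (8:ℝ) ^ (1:ℝ) ≤ 8 ^ ((3:ℝ)/2) :=
        Real.rpow_le_rpow_of_exponent_le (by norm_num) (by norm_num)
      rw [Real.rpow_one] at q1 q2
      linarith
    have s2 : (8 * c ^ 3) ^ ((3:ℝ)/2) ≤ (a * (2 * m + 2) * (2 * m + 1)) ^ ((3:ℝ)/2) :=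
      Real.rpow_le_rpow (by positivity) B1 (by norm_num)
    calc ((1 / 100) * c ^ 3) ^ ((3:ℝ)/2) * (1 / c)
        ≤ (1 / 8) * (8 * c ^ 3) ^ ((3:ℝ)/2) * (1 / c) := by gcongr
      _ = (8 * c ^ 3) ^ ((3:ℝ)/2) * ((1 / 8) * (1 / c)) := by ring
      _ ≤ _ := by gcongr
  · rw [← e 200 (by norm_num)]
    refine Real.rpow_le_rpow (by positivity) ?_ (by norm_num)
    gcongr

end NS
namespace NS

/-- existence of Poiseuille-type profiles `V_c = (v_c(x₂),0)` with
flux `c`, the asymptotics `‖v_c‖_{L^∞} ∼ c`, `‖v_c'‖_{L²} ∼ c^{3/2}`,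
`‖v_c''‖_{L^{3/2}} ∼ c^{7/3}` for large `c`, and energy stability of the
linearised operator `L_c w = -Δw + (V_c,∇)w + (w,∇)V_c`. -/
theorem poiseuille_profile :
    ∃ κ > (0:ℝ), ∃ c₀ > (0:ℝ), ∃ k₁ > (0:ℝ), ∃ k₂ > (0:ℝ), ∃ k₃ > (0:ℝ),
      ∃ k₄ > (0:ℝ), ∃ k₅ > (0:ℝ), ∃ k₆ > (0:ℝ), ∃ f : ℝ → ℝ → ℝ, ∀ c : ℝ,
        IsPoiseuille c (fun x => (f c x.2, 0)) ∧
        (c₀ ≤ c →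
          (k₁ * c ≤ (⨆ y : Icc (-1:ℝ) 1, |f c ↑y|) ∧
            (⨆ y : Icc (-1:ℝ) 1, |f c ↑y|) ≤ k₂ * c) ∧
          (k₃ * c ^ ((3:ℝ)/2)
              ≤ (∫ y in Ioo (-1:ℝ) 1, deriv (f c) y ^ 2) ^ ((1:ℝ)/2) ∧
            (∫ y in Ioo (-1:ℝ) 1, deriv (f c) y ^ 2) ^ ((1:ℝ)/2)
              ≤ k₄ * c ^ ((3:ℝ)/2)) ∧
          (k₅ * c ^ ((7:ℝ)/3)
              ≤ (∫ y in Ioo (-1:ℝ) 1,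
                  |deriv (deriv (f c)) y| ^ ((3:ℝ)/2)) ^ ((2:ℝ)/3) ∧
            (∫ y in Ioo (-1:ℝ) 1,
                  |deriv (deriv (f c)) y| ^ ((3:ℝ)/2)) ^ ((2:ℝ)/3)
              ≤ k₆ * c ^ ((7:ℝ)/3))) ∧
        (∀ w : Pt → Pt, ContDiff ℝ (⊤ : ℕ∞) w → HasCompactSupport w → tsupport w ⊆ Strip →
          (∀ x, div2 w x = 0) →
          κ * (∫ x in Strip, (nsq (w x) + gnsq w x))
            ≤ ∫ x in Strip, dot (w x)
                (-(lap w x) + fderiv ℝ w x ((f c x.2, 0) : Pt)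
                  + fderiv ℝ (fun y : Pt => ((f c y.2, 0) : Pt)) x (w x))) := by
  refine ⟨1 / 4, by norm_num, 1, one_pos, 1, one_pos, 3 / 2, by norm_num, 1, one_pos, 10,
    by norm_num, 1 / 100, by norm_num, 200, by norm_num, fun c => prof (mm c) (aa c), fun c => ?_⟩
  refine ⟨is_pois c, fun hc => ?_, fun w hw hs ht _ => ?_⟩
  · have hb := aa_bounds c (by linarith)
    have ha : 0 ≤ aa c := by linarith
    rw [prof_sup _ _ ha, prof_D1, prof_D2 _ _ ha, one_mul]
    exact ⟨hb, D1_bounds c hc, D2_bounds c hc⟩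
  · exact energy _ (prof_smooth _ _) (by rw [prof_M]; exact M_bound c) w hw hs ht


end NS
end
end

section
/- Let Ω = ℝ × (−1,1) and let φ : ℝ → (0,∞) be a weight function of exponential growth rate μ with μ sufficiently small (in particular φ = θ_{ε,s} with ε > 0 small). Then the weighted Ladyzhenskaya inequality ‖u‖²_{L⁴_φ(Ω)} ≤ C ‖u‖_{L²_φ(Ω)} ‖u‖_{W^{1,2}_φ(Ω)} holds for all u ∈ W^{1,2}_φ(Ω), where the constant C depends only on μ and on the constant in the exponential growth condition, and is independent of the concrete choice of φ. -/
noncomputable section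
open MeasureTheory Real Set Filter

namespace NS

open scoped ENNReal

/-- One-dimensional bound `h(x)² ≤ ∫_a^{a+1} (h² + 2|h h'|)`. -/
theorem one_dim_bound (h h' : ℝ → ℝ) (hd : ∀ t, HasDerivAt h (h' t) t) (hm : Measurable h')
    (a x : ℝ) (hx : x ∈ Icc a (a+1)) :
    ENNReal.ofReal (h x ^ 2) ≤
      ∫⁻ t in Ioo a (a+1), ENNReal.ofReal (h t ^ 2 + 2 * |h t * h' t|) := by
  by_cases htop : ∫⁻ t in Ioo a (a+1), ENNReal.ofReal (h t ^ 2 + 2 * |h t * h' t|) = ⊤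
  · rw [htop]; exact le_top
  have hc : Continuous h := continuous_iff_continuousAt.2 fun t => (hd t).continuousAt
  have hmh : Measurable h := hc.measurable
  have hI0 : IntegrableOn (fun t => h t ^ 2 + 2 * |h t * h' t|) (Ioo a (a+1)) := by
    refine ⟨Measurable.aestronglyMeasurable (by fun_prop), ?_⟩
    rw [hasFiniteIntegral_iff_ofReal (ae_of_all _ fun t => by positivity)]
    exact lt_top_iff_ne_top.2 htop
  rw [← ofReal_integral_eq_lintegral_ofReal hI0 (ae_of_all _ fun t => by positivity)]
  apply ENNReal.ofReal_le_ofReal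
  have hI : IntegrableOn (fun t => h t ^ 2 + 2 * |h t * h' t|) (Icc a (a+1)) :=
    (integrableOn_Icc_iff_integrableOn_Ioo).2 hI0
  have hJ : IntegrableOn (fun t => 2 * h t * h' t) (Icc a (a+1)) := by
    refine Integrable.mono' hI (Measurable.aestronglyMeasurable (by fun_prop)) ?_
    refine ae_of_all _ fun t => ?_
    have : ‖2 * h t * h' t‖ = 2 * |h t * h' t| := by
      rw [Real.norm_eq_abs, mul_assoc, abs_mul]; simp
    rw [this]; nlinarith [sq_nonneg (h t)]
  have hsq : IntegrableOn (fun t => h t ^ 2) (Icc a (a+1)) :=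
    (hc.pow 2).continuousOn.integrableOn_Icc
  have hK : IntegrableOn (fun t => 2 * |h t * h' t|) (Icc a (a+1)) := by
    have := hI.sub hsq
    refine this.congr (ae_of_all _ fun t => ?_)
    simp
  set M := ∫ t in Icc a (a+1), 2 * |h t * h' t| with hM
  have key : ∀ t ∈ Icc a (a+1), h x ^ 2 ≤ h t ^ 2 + M := by
    intro t ht
    have hsub : uIcc t x ⊆ Icc a (a+1) := uIcc_subset_Icc ht hx
    have hii : IntervalIntegrable (fun t => 2 * h t * h' t) volume t x :=
      (hJ.mono_set hsub).intervalIntegrable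
    have hftc := intervalIntegral.integral_eq_sub_of_hasDerivAt (a := t) (b := x)
      (f := fun s => h s ^ 2) (f' := fun s => 2 * h s * h' s)
      (fun s _ => by
        have := (hd s).fun_pow 2
        norm_num at this
        exact this) hii
    have h1 : ‖∫ s in t..x, 2 * h s * h' s‖ ≤ ∫ s in uIoc t x, ‖2 * h s * h' s‖ :=
      intervalIntegral.norm_integral_le_integral_norm_uIoc
    have h2 : ∫ s in uIoc t x, ‖2 * h s * h' s‖ ≤ M := by
      have : (fun s => ‖2 * h s * h' s‖) = fun s => 2 * |h s * h' s| := by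
        ext s; rw [Real.norm_eq_abs, mul_assoc, abs_mul]; simp
      rw [this]
      exact setIntegral_mono_set hK (ae_of_all _ fun s => by positivity)
        (LE.le.eventuallyLE (uIoc_subset_uIcc.trans hsub))
    have h3 := le_abs_self (∫ s in t..x, 2 * h s * h' s)
    rw [Real.norm_eq_abs] at h1
    linarith
  have h4 : ∫ t in Icc a (a+1), h x ^ 2 ≤ ∫ t in Icc a (a+1), (h t ^ 2 + M) :=
    setIntegral_mono_on (by simp) (hsq.add (by simp)) measurableSet_Icc key
  rw [integral_add hsq (by simp)] at h4
  simp at h4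
  rw [← integral_Icc_eq_integral_Ioo, integral_add hsq hK]
  exact h4

theorem hasDerivAt_x (u : Pt → ℝ) (hu : Differentiable ℝ u) (y t : ℝ) :
    HasDerivAt (fun s => u (s, y)) (pd e1 u (t, y)) t := by
  have h1 := (hu (t, y)).hasFDerivAt
  have h2 : HasDerivAt (fun s : ℝ => ((s, y) : Pt)) e1 t :=
    (hasDerivAt_id t).prodMk (hasDerivAt_const t y)
  exact h1.comp_hasDerivAt t h2

theorem hasDerivAt_y (u : Pt → ℝ) (hu : Differentiable ℝ u) (x t : ℝ) :
    HasDerivAt (fun s => u (x, s)) (pd e2 u (x, t)) t := by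
  have h1 := (hu (x, t)).hasFDerivAt
  have h2 : HasDerivAt (fun s : ℝ => ((x, s) : Pt)) e2 t :=
    (hasDerivAt_const t x).prodMk (hasDerivAt_id t)
  exact h1.comp_hasDerivAt t h2

/-- Cauchy--Schwarz step. -/
theorem cs_step (m : Measure Pt) (P H G : Pt → ℝ) (hP : AEMeasurable P m) (hH : AEMeasurable H m)
    (hP0 : ∀ x, 0 ≤ P x) (hH0 : ∀ x, 0 ≤ H x) (hG : ∀ x, G x ≤ √(P x) * √(8 * H x)) :
    ∫⁻ x, ENNReal.ofReal (G x) ∂m ≤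
      (∫⁻ x, ENNReal.ofReal (P x) ∂m) ^ ((1:ℝ)/2)
        * (8 * ∫⁻ x, ENNReal.ofReal (H x) ∂m) ^ ((1:ℝ)/2) := by
  have h1 : ∫⁻ x, ENNReal.ofReal (G x) ∂m ≤
      ∫⁻ x, ((fun x => ENNReal.ofReal √(P x)) * (fun x => ENNReal.ofReal √(8 * H x))) x ∂m := by
    refine lintegral_mono fun x => ?_
    simp only [Pi.mul_apply]
    rw [← ENNReal.ofReal_mul (Real.sqrt_nonneg _)]
    exact ENNReal.ofReal_le_ofReal (hG x)
  refine h1.trans ((ENNReal.lintegral_mul_le_Lp_mul_Lq m Real.HolderConjugate.two_two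
    (by fun_prop) (by fun_prop)).trans (le_of_eq ?_))
  congr 2
  · refine lintegral_congr fun x => ?_
    rw [ENNReal.ofReal_rpow_of_nonneg (Real.sqrt_nonneg _) (by norm_num), Real.rpow_two,
      Real.sq_sqrt (hP0 x)]
  · rw [← lintegral_const_mul' _ _ (by norm_num)]
    refine lintegral_congr fun x => ?_
    rw [ENNReal.ofReal_rpow_of_nonneg (Real.sqrt_nonneg _) (by norm_num), Real.rpow_two,
      Real.sq_sqrt (by have := hH0 x; positivity), ENNReal.ofReal_mul (by norm_num)]
    simp

theorem cs_point (p a b w : ℝ) (hp : 0 < p) (hw : a ^ 2 + b ^ 2 ≤ w) :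
    p ^ 2 * (a ^ 2 + 2 * |a * b|) ≤ √(p ^ 2 * a ^ 2) * √(8 * (p ^ 2 * w)) := by
  have h1 : √(p ^ 2 * a ^ 2) = p * |a| := by
    rw [← mul_pow, Real.sqrt_sq_eq_abs, abs_mul, abs_of_pos hp]
  have h2 : p * (|a| + 2 * |b|) ≤ √(8 * (p ^ 2 * w)) := by
    apply Real.le_sqrt_of_sq_le
    have h3 : (|a| + 2 * |b|) ^ 2 ≤ 8 * w := by
      nlinarith [sq_nonneg (2 * |a| - |b|), sq_abs a, sq_abs b, sq_nonneg (|a|), sq_nonneg (|b|),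
        sq_nonneg (|a| - |b|)]
    have : 0 < p ^ 2 := by positivity
    nlinarith
  rw [h1, abs_mul]
  calc p ^ 2 * (a ^ 2 + 2 * (|a| * |b|)) = p * |a| * (p * (|a| + 2 * |b|)) := by
        rw [← sq_abs a]; ring
    _ ≤ _ := by gcongr

/-- The weighted inequality in terms of lower Lebesgue integrals. -/
theorem lintegral_bound (K : ℝ) (hK : 0 < K) (φ : ℝ → ℝ) (hφ : ∀ x, 0 < φ x)
    (hφK : ∀ x t, t ∈ Icc x (x+1) → φ x ≤ K * φ t) (u : Pt → ℝ) (hu : Differentiable ℝ u)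
    (m : Measure Pt) (hm : m = (volume : Measure ℝ).prod (volume.restrict (Ioo (-1:ℝ) 1)))
    (h1 : AEMeasurable (fun x : Pt => φ x.1 ^ 2 * (u x ^ 2 + 2 * |u x * pd e1 u x|)) m)
    (h2 : AEMeasurable (fun x : Pt => φ x.1 ^ 2 * (u x ^ 2 + 2 * |u x * pd e2 u x|)) m) :
    ∫⁻ x, ENNReal.ofReal (φ x.1 ^ 4 * u x ^ 4) ∂m ≤ ENNReal.ofReal (K ^ 2) *
      ((∫⁻ x, ENNReal.ofReal (φ x.1 ^ 2 * (u x ^ 2 + 2 * |u x * pd e2 u x|)) ∂m) *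
      ∫⁻ x, ENNReal.ofReal (φ x.1 ^ 2 * (u x ^ 2 + 2 * |u x * pd e1 u x|)) ∂m) := by
  subst hm
  have hm1 : Measurable (pd e1 u) := measurable_fderiv_apply_const ℝ u e1
  have hm2 : Measurable (pd e2 u) := measurable_fderiv_apply_const ℝ u e2
  have k1 := h1.ennreal_ofReal
  have k2 := h2.ennreal_ofReal
  rw [lintegral_prod _ k2, lintegral_prod_symm _ k1,
    ← lintegral_prod_mul k2.lintegral_prod_right' k1.lintegral_prod_left',
    ← lintegral_const_mul' _ _ ENNReal.ofReal_ne_top]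
  have hmem : ∀ᵐ z ∂((volume : Measure ℝ).prod (volume.restrict (Ioo (-1:ℝ) 1))),
      z.2 ∈ Ioo (-1:ℝ) 1 := by
    have := ae_restrict_mem (μ := (volume : Measure ℝ)) (measurableSet_Ioo (a := (-1:ℝ)) (b := 1))
    exact (Measure.quasiMeasurePreserving_snd).ae this
  refine lintegral_mono_ae ?_
  filter_upwards [hmem] with z hz
  obtain ⟨x, y⟩ := z
  simp only at hz ⊢
  have A : ENNReal.ofReal (φ x ^ 2 * u (x, y) ^ 2) ≤
      ∫⁻ t in Ioo (-1:ℝ) 1, ENNReal.ofReal (φ x ^ 2 *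
        (u (x, t) ^ 2 + 2 * |u (x, t) * pd e2 u (x, t)|)) := by
    have B : ENNReal.ofReal (u (x, y) ^ 2) ≤ ∫⁻ t in Ioo (-1:ℝ) 1,
        ENNReal.ofReal (u (x, t) ^ 2 + 2 * |u (x, t) * pd e2 u (x, t)|) := by
      obtain ⟨a, ha, hya⟩ : ∃ a, Ioo a (a+1) ⊆ Ioo (-1:ℝ) 1 ∧ y ∈ Icc a (a+1) := by
        rcases le_total y 0 with h | h
        · exact ⟨y, Ioo_subset_Ioo hz.1.le (by linarith), by simp⟩
        · exact ⟨y - 1, Ioo_subset_Ioo (by linarith) (by linarith [hz.2]), by simp⟩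
      exact (one_dim_bound (fun s => u (x, s)) (fun s => pd e2 u (x, s)) (hasDerivAt_y u hu x)
        (by fun_prop) a y hya).trans (lintegral_mono_set ha)
    simp_rw [ENNReal.ofReal_mul (sq_nonneg (φ x))]
    rw [lintegral_const_mul' _ _ ENNReal.ofReal_ne_top]
    gcongr
  have A' : ENNReal.ofReal (φ x ^ 2 * u (x, y) ^ 2) ≤ ENNReal.ofReal (K ^ 2) *
      ∫⁻ t, ENNReal.ofReal (φ t ^ 2 *
        (u (t, y) ^ 2 + 2 * |u (t, y) * pd e1 u (t, y)|)) := by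
    have B := one_dim_bound (fun s => u (s, y)) (fun s => pd e1 u (s, y)) (hasDerivAt_x u hu y)
        (by fun_prop) x x (by simp)
    rw [ENNReal.ofReal_mul (sq_nonneg (φ x))]
    refine (mul_le_mul_right B _).trans ?_
    rw [← lintegral_const_mul' _ _ ENNReal.ofReal_ne_top,
      ← lintegral_const_mul' _ _ ENNReal.ofReal_ne_top]
    refine le_trans ?_ (setLIntegral_le_lintegral (Ioo x (x+1)) _)
    refine setLIntegral_mono' measurableSet_Ioo fun t ht => ?_
    rw [← ENNReal.ofReal_mul (by positivity), ← ENNReal.ofReal_mul (by positivity)]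
    apply ENNReal.ofReal_le_ofReal
    rw [← mul_assoc, ← mul_pow]
    have := hφK x t (Ioo_subset_Icc_self ht)
    have := (hφ x).le
    gcongr
  have : φ x ^ 4 * u (x, y) ^ 4 = (φ x ^ 2 * u (x, y) ^ 2) * (φ x ^ 2 * u (x, y) ^ 2) := by ring
  rw [this, ENNReal.ofReal_mul (by positivity)]
  refine (mul_le_mul' A A').trans (le_of_eq ?_)
  ring

theorem restrict_strip : (volume : Measure Pt).restrict Strip =
    (volume : Measure ℝ).prod (volume.restrict (Ioo (-1:ℝ) 1)) := by
  have : Strip = (univ : Set ℝ) ×ˢ Ioo (-1:ℝ) 1 := by ext x; simp [Strip]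
  rw [this, Measure.volume_eq_prod, ← Measure.prod_restrict, Measure.restrict_univ]

/-- weighted Ladyzhenskaya inequality
`‖u‖²_{L⁴_φ} ≤ C‖u‖_{L²_φ}‖u‖_{W^{1,2}_φ}` on the strip. -/
theorem weighted_ladyzhenskaya :
    ∀ Cg > (0:ℝ), ∃ μ₀ > (0:ℝ), ∃ C > (0:ℝ), ∀ μ ∈ Set.Ioc (0:ℝ) μ₀,
      ∀ φ : ℝ → ℝ, ExpGrowth μ Cg φ →
        ∀ u : Pt → ℝ, Differentiable ℝ u →
          IntegrableOn
            (fun x => φ x.1 ^ 2 * (u x ^ 2 + (pd e1 u x) ^ 2 + (pd e2 u x) ^ 2)) Strip →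
          (∫ x in Strip, φ x.1 ^ 4 * u x ^ 4) ^ ((1:ℝ)/2)
            ≤ C * (∫ x in Strip, φ x.1 ^ 2 * u x ^ 2) ^ ((1:ℝ)/2)
                * (∫ x in Strip,
                    φ x.1 ^ 2 * (u x ^ 2 + (pd e1 u x) ^ 2 + (pd e2 u x) ^ 2)) ^ ((1:ℝ)/2) := by
  intro Cg hCg
  refine ⟨1, one_pos, 3 * (Cg * Real.exp 1), by positivity, ?_⟩
  rintro μ ⟨hμ0, hμ1⟩ φ ⟨hφ, hgr⟩ u hu hint
  set K := Cg * Real.exp 1 with hKdef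
  have hK : 0 < K := by positivity
  have hφK : ∀ x t, t ∈ Icc x (x+1) → φ x ≤ K * φ t := by
    intro x t ht
    have h := hgr t (x - t)
    rw [add_sub_cancel] at h
    refine h.trans ?_
    have h1 : |x - t| ≤ 1 := by rw [abs_le]; constructor <;> linarith [ht.1, ht.2]
    have h2 : μ * |x - t| ≤ 1 := by nlinarith [abs_nonneg (x - t)]
    have := (hφ t).le
    rw [hKdef]
    gcongr
  have hm1 : Measurable (pd e1 u) := measurable_fderiv_apply_const ℝ u e1
  have hm2 : Measurable (pd e2 u) := measurable_fderiv_apply_const ℝ u e2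
  have hmu : Measurable u := hu.continuous.measurable
  unfold IntegrableOn at hint
  set m := (volume : Measure Pt).restrict Strip with hmdef
  set w : Pt → ℝ := fun x => u x ^ 2 + (pd e1 u x) ^ 2 + (pd e2 u x) ^ 2 with hw
  have hF : AEMeasurable (fun x : Pt => φ x.1 ^ 2 * w x) m := hint.aemeasurable
  have trans : ∀ g : Pt → ℝ, Measurable g → (∀ x, w x = 0 → g x = 0) →
      AEMeasurable (fun x : Pt => φ x.1 ^ 2 * g x) m := by
    intro g hg hg0
    have : (fun x : Pt => φ x.1 ^ 2 * g x) = fun x => (φ x.1 ^ 2 * w x) * (g x / w x) := by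
      ext x
      by_cases h : w x = 0
      · simp [h, hg0 x h]
      · field_simp
    rw [this]
    exact hF.mul (Measurable.aemeasurable (by fun_prop))
  have w0 : ∀ x, w x = 0 → u x = 0 := by
    intro x hx
    have : u x ^ 2 = 0 := by
      simp only [hw] at hx
      nlinarith [sq_nonneg (u x), sq_nonneg (pd e1 u x), sq_nonneg (pd e2 u x)]
    simpa using this
  have hP := trans (fun x => u x ^ 2) (by fun_prop) (fun x hx => by simp [w0 x hx])
  have hG1 := trans (fun x => u x ^ 2 + 2 * |u x * pd e1 u x|) (by fun_prop)
    (fun x hx => by simp [w0 x hx])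
  have hG2 := trans (fun x => u x ^ 2 + 2 * |u x * pd e2 u x|) (by fun_prop)
    (fun x hx => by simp [w0 x hx])
  have hw_nn : ∀ x, 0 ≤ w x := fun x => by simp only [hw]; positivity
  have hPint : Integrable (fun x : Pt => φ x.1 ^ 2 * u x ^ 2) m := by
    refine hint.mono' hP.aestronglyMeasurable (ae_of_all _ fun x => ?_)
    rw [Real.norm_of_nonneg (by positivity)]
    have : u x ^ 2 ≤ w x := by simp only [hw]; nlinarith [sq_nonneg (pd e1 u x), sq_nonneg (pd e2 u x)]
    gcongr
  have hmain := lintegral_bound K hK φ hφ hφK u hu m restrict_strip hG1 hG2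
  have c1 := cs_step m _ _ (fun x : Pt => φ x.1 ^ 2 * (u x ^ 2 + 2 * |u x * pd e1 u x|)) hP hF
    (fun x => by positivity) (fun x => mul_nonneg (sq_nonneg _) (hw_nn x))
    (fun x => cs_point _ _ _ _ (hφ x.1) (by simp only [hw]; nlinarith [sq_nonneg (pd e2 u x)]))
  have c2 := cs_step m _ _ (fun x : Pt => φ x.1 ^ 2 * (u x ^ 2 + 2 * |u x * pd e2 u x|)) hP hF
    (fun x => by positivity) (fun x => mul_nonneg (sq_nonneg _) (hw_nn x))
    (fun x => cs_point _ _ _ _ (hφ x.1) (by simp only [hw]; nlinarith [sq_nonneg (pd e1 u x)]))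
  have hfin := hmain.trans (mul_le_mul_right (mul_le_mul' c2 c1) _)
  rw [← ofReal_integral_eq_lintegral_ofReal hPint (ae_of_all _ fun x => by positivity),
    ← ofReal_integral_eq_lintegral_ofReal hint
      (ae_of_all _ fun x => mul_nonneg (sq_nonneg _) (hw_nn x))] at hfin
  set A := ∫ x, φ x.1 ^ 2 * u x ^ 2 ∂m with hA
  set B := ∫ x, φ x.1 ^ 2 * w x ∂m with hB
  have hA0 : 0 ≤ A := integral_nonneg fun x => by positivity
  have hB0 : 0 ≤ B := integral_nonneg fun x => mul_nonneg (sq_nonneg _) (hw_nn x)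
  have e8 : (8 : ℝ≥0∞) = ENNReal.ofReal 8 := by simp
  rw [e8, ← ENNReal.ofReal_mul (by norm_num),
    ENNReal.ofReal_rpow_of_nonneg hA0 (by norm_num),
    ENNReal.ofReal_rpow_of_nonneg (by positivity) (by norm_num),
    ← ENNReal.ofReal_mul (by positivity), ← ENNReal.ofReal_mul (by positivity),
    ← ENNReal.ofReal_mul (by positivity)] at hfin
  have hL : ∫ x, φ x.1 ^ 4 * u x ^ 4 ∂m ≤
      K ^ 2 * (A ^ ((1:ℝ)/2) * (8 * B) ^ ((1:ℝ)/2) * (A ^ ((1:ℝ)/2) * (8 * B) ^ ((1:ℝ)/2))) := by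
    have hmeas : AEStronglyMeasurable (fun x : Pt => φ x.1 ^ 4 * u x ^ 4) m := by
      have : (fun x : Pt => φ x.1 ^ 4 * u x ^ 4) = fun x => (φ x.1 ^ 2 * u x ^ 2) ^ 2 := by
        ext x; ring
      rw [this]
      exact (hP.pow_const 2).aestronglyMeasurable
    rw [integral_eq_lintegral_of_nonneg_ae (ae_of_all _ fun x => by positivity) hmeas]
    exact ENNReal.toReal_le_of_le_ofReal (by positivity) hfin
  simp only [← Real.sqrt_eq_rpow] at hL ⊢
  have : K ^ 2 * (√A * √(8 * B) * (√A * √(8 * B))) = 8 * (K ^ 2 * A * B) := by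
    have h1 := Real.mul_self_sqrt hA0
    have h2 := Real.mul_self_sqrt (show 0 ≤ 8 * B by positivity)
    calc _ = K ^ 2 * (√A * √A) * (√(8 * B) * √(8 * B)) := by ring
      _ = _ := by rw [h1, h2]; ring
  rw [this] at hL
  apply Real.sqrt_le_iff.2 ⟨by positivity, ?_⟩
  rw [mul_pow, mul_pow, Real.sq_sqrt hA0, Real.sq_sqrt hB0]
  have : 0 ≤ K ^ 2 * A * B := by positivity
  nlinarith

end NS
end
end
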